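/- (Optimality over (v,x) in the dual barrier computation) Fix ρ > 0, s ∈ ℂ^N, and u with T(u) ≻ 0. The concave function h(v,x) = −ρv − Re(sᴴx) + log(v − xᴴT(u)^{-1}x), defined on {(v,x) : v > xᴴT(u)^{-1}x}, attains its maximum at v* = ρ^{-1} + (2ρ)^{-2} sᴴT(u)s and x* = −(2ρ)^{-1} T(u)s, with maximal value −1 − log ρ + (1/(4ρ)) sᴴ T(u) s. -/

import Mathlib

open Complex Matrix ComplexOrder

noncomputable section

/-- Hermitian Toeplitz matrix with first row `(2u₀, u₁ + j u_N, …, u_{N-1} + j u_{2N-2})`. -/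
def Tmat (N : ℕ) (u : Fin (2*N-1) → ℝ) : Matrix (Fin N) (Fin N) ℂ :=
  fun n m =>
    let g : ℕ → ℝ := fun k => if h : k < 2*N-1 then u ⟨k, h⟩ else 0
    let r : ℕ → ℂ := fun k =>
      if k = 0 then ((2 * g 0 : ℝ) : ℂ) else ((g k : ℝ) : ℂ) + Complex.I * ((g (N-1+k) : ℝ) : ℂ)
    if (n : ℕ) ≤ (m : ℕ) then r ((m : ℕ) - (n : ℕ)) else star (r ((n : ℕ) - (m : ℕ)))

theorem expand_aux {N : ℕ} (T : Matrix (Fin N) (Fin N) ℂ) (hT : T.PosDef) (s x : Fin N → ℂ)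
    (c : ℝ) :
    (star (x + (c : ℂ) • (T *ᵥ s)) ⬝ᵥ (T⁻¹ *ᵥ (x + (c : ℂ) • (T *ᵥ s)))).re
      = (star x ⬝ᵥ (T⁻¹ *ᵥ x)).re + 2 * c * (star s ⬝ᵥ x).re
        + c ^ 2 * (star s ⬝ᵥ (T *ᵥ s)).re := by
  have hdet : IsUnit T.det := (Matrix.isUnit_iff_isUnit_det T).1 hT.isUnit
  have h1 : T⁻¹ *ᵥ (T *ᵥ s) = s := by
    rw [Matrix.mulVec_mulVec, Matrix.nonsing_inv_mul T hdet, Matrix.one_mulVec]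
  have h2 : star (T *ᵥ s) ⬝ᵥ (T⁻¹ *ᵥ x) = star s ⬝ᵥ x := by
    rw [Matrix.star_mulVec, hT.isHermitian.eq, ← Matrix.dotProduct_mulVec, Matrix.mulVec_mulVec,
      Matrix.mul_nonsing_inv T hdet, Matrix.one_mulVec]
  have h3 : star (T *ᵥ s) ⬝ᵥ s = star s ⬝ᵥ (T *ᵥ s) := by
    rw [Matrix.star_mulVec, hT.isHermitian.eq, ← Matrix.dotProduct_mulVec]
  have h4 : (star x ⬝ᵥ s).re = (star s ⬝ᵥ x).re := by
    have : star x ⬝ᵥ s = star (star s ⬝ᵥ x) := by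
      rw [Matrix.star_dotProduct]
    rw [this]; simp
  rw [Matrix.mulVec_add, Matrix.mulVec_smul, h1, star_add, star_smul, add_dotProduct,
    dotProduct_add, dotProduct_add, smul_dotProduct, smul_dotProduct, dotProduct_smul,
    dotProduct_smul, h2, h3]
  simp [h4]
  ring

/-- the maximizer over (v,x) in the dual barrier computation. -/
theorem stmt18 (N : ℕ) (hN : 1 ≤ N) (ρ : ℝ) (hρ : 0 < ρ) (s : Fin N → ℂ)
    (u : Fin (2*N-1) → ℝ) (hT : (Tmat N u).PosDef) :
    letI T := Tmat N u
    letI h : ℝ → (Fin N → ℂ) → ℝ := fun v x =>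
      -(ρ * v) - (star s ⬝ᵥ x).re + Real.log (v - (star x ⬝ᵥ (T⁻¹ *ᵥ x)).re)
    letI vstar : ℝ := ρ⁻¹ + ((2*ρ)^2)⁻¹ * (star s ⬝ᵥ (T *ᵥ s)).re
    letI xstar : Fin N → ℂ := fun i => -((2*ρ : ℂ))⁻¹ * (T *ᵥ s) i
    ((vstar - (star xstar ⬝ᵥ (T⁻¹ *ᵥ xstar)).re > 0) ∧
     (∀ (v : ℝ) (x : Fin N → ℂ), v - (star x ⬝ᵥ (T⁻¹ *ᵥ x)).re > 0 →
        h v x ≤ h vstar xstar) ∧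
     h vstar xstar = -1 - Real.log ρ + (1/(4*ρ)) * (star s ⬝ᵥ (T *ᵥ s)).re) := by
  have key := expand_aux (Tmat N u) hT s
  have hpos : ∀ y : Fin N → ℂ, 0 ≤ (star y ⬝ᵥ ((Tmat N u)⁻¹ *ᵥ y)).re := fun y =>
    hT.inv.posSemidef.re_dotProduct_nonneg y
  generalize Tmat N u = T at *
  have hx : (fun i => -((2*ρ : ℂ))⁻¹ * (T *ᵥ s) i) = (((-(2*ρ)⁻¹ : ℝ)) : ℂ) • (T *ᵥ s) := by
    ext i; simp
  have hq := key 0 (-(2*ρ)⁻¹)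
  simp only [zero_add, star_zero, zero_dotProduct, dotProduct_zero, Complex.zero_re, mul_zero] at hq
  have hsx : (star s ⬝ᵥ ((((-(2*ρ)⁻¹ : ℝ)) : ℂ) • (T *ᵥ s))).re
      = -(2*ρ)⁻¹ * (star s ⬝ᵥ (T *ᵥ s)).re := by
    rw [dotProduct_smul, smul_eq_mul, Complex.re_ofReal_mul]
  have hw : ρ⁻¹ + ((2*ρ)^2)⁻¹ * (star s ⬝ᵥ (T *ᵥ s)).re
      - (-(2*ρ)⁻¹) ^ 2 * (star s ⬝ᵥ (T *ᵥ s)).re = ρ⁻¹ := by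
    field_simp; ring
  have hval : -(ρ * (ρ⁻¹ + ((2*ρ)^2)⁻¹ * (star s ⬝ᵥ (T *ᵥ s)).re))
      - -(2*ρ)⁻¹ * (star s ⬝ᵥ (T *ᵥ s)).re + Real.log ρ⁻¹
      = -1 - Real.log ρ + (1/(4*ρ)) * (star s ⬝ᵥ (T *ᵥ s)).re := by
    rw [Real.log_inv]; field_simp; ring
  simp only [hx, hq, hsx, hw, hval]
  refine ⟨inv_pos.2 hρ, ?_, trivial⟩
  intro v x hv
  have h1 := hpos (x + (((2*ρ)⁻¹ : ℝ) : ℂ) • (T *ᵥ s))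
  rw [key] at h1
  have h2 := Real.log_le_sub_one_of_pos (mul_pos hρ hv)
  rw [Real.log_mul hρ.ne' (ne_of_gt hv)] at h2
  have h3 := mul_nonneg hρ.le h1
  have h4 : ρ * ((star x ⬝ᵥ (T⁻¹ *ᵥ x)).re + 2 * (2*ρ)⁻¹ * (star s ⬝ᵥ x).re
        + ((2*ρ)⁻¹) ^ 2 * (star s ⬝ᵥ (T *ᵥ s)).re) = ρ * (star x ⬝ᵥ (T⁻¹ *ᵥ x)).re
        + (star s ⬝ᵥ x).re + (1/(4*ρ)) * (star s ⬝ᵥ (T *ᵥ s)).re := by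
    field_simp; ring
  rw [h4] at h3
  linarith
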